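/- arXiv:2001.10917 — 2 statements merged into one kernel-verified Lean document; each statement's English description precedes it below -/
import Mathlib

section
/- Let φ denote the density of the standard d-dimensional normal distribution, and for a bounded measurable f : ℝ^d → ℝ and σ > 0 define 𝒩_σ f(x) = ∫_{ℝ^d} f(x + σz) φ(z) dz. Fix a constant K ≥ 0 and an integer r ≥ 1, and for each d ≥ 3 set η = K/√(log d). Then there is a constant C_{K,r} > 0 depending only on K and r such that for all d ≥ 3, all σ > 0 and all h = 1_A with A ∈ 𝓡: sup_{x∈ℝ^d} ∑_{j_1,…,j_r=1}^d sup_{y : ‖y‖_∞ ≤ ση} |∂_{j_1 ⋯ j_r} 𝒩_σ h(x + y)| ≤ C_{K,r} σ^{−r} (log d)^{r/2}. -/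
open MeasureTheory Real

noncomputable section

/-- Density of the standard `d`-dimensional normal distribution. -/
def stdGaussianPdf (d : ℕ) (x : Fin d → ℝ) : ℝ :=
  (2 * π) ^ (-(d : ℝ) / 2) * Real.exp (-(∑ j, x j ^ 2) / 2)

/-- `A` is a hyperrectangle `∏ (a_j, b_j)` with `-∞ ≤ a_j ≤ b_j ≤ ∞`. -/
def IsHyperrectangle {d : ℕ} (A : Set (Fin d → ℝ)) : Prop :=
  ∃ a b : Fin d → EReal, A = {x | ∀ j, a j < (x j : EReal) ∧ (x j : EReal) < b j}

/-- Iterated partial derivative `∂_{j_1 ⋯ j_r} f` along a list of coordinates. -/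
def pdSeq {d : ℕ} : List (Fin d) → ((Fin d → ℝ) → ℝ) → ((Fin d → ℝ) → ℝ)
  | [], f => f
  | j :: js, f => pdSeq js fun x => fderiv ℝ f x (Pi.single j 1)

/-- The Gaussian smoothing `𝒩_σ f` of a function `f` on `ℝ^d`. -/
def gaussianSmooth {d : ℕ} (σ : ℝ) (f : (Fin d → ℝ) → ℝ) (x : Fin d → ℝ) : ℝ :=
  ∫ z, f (x + σ • z) * stdGaussianPdf d z ∂volume

/-- Polynomial factors of the derivatives of the Gaussian density. -/
def gP : ℕ → Polynomial ℝ
  | 0 => 1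
  | m + 1 => Polynomial.derivative (gP m) - Polynomial.X * gP m

/-- Normalising constant in dimension one. -/
def gc : ℝ := (2 * π) ^ (-(1 / 2) : ℝ)

/-- Derivatives of the one-dimensional Gaussian density. -/
def gpsi (m : ℕ) (u : ℝ) : ℝ := gc * ((gP m).eval u * Real.exp (-u ^ 2 / 2))

lemma gc_pos : 0 < gc := by unfold gc; positivity

lemma gpsi_hasDerivAt (m : ℕ) (u : ℝ) : HasDerivAt (gpsi m) (gpsi (m + 1) u) u := by
  unfold gpsi
  have h1 := (gP m).hasDerivAt u
  have h2 : HasDerivAt (fun u : ℝ => Real.exp (-u ^ 2 / 2)) (Real.exp (-u ^ 2 / 2) * (-u)) u := by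
    have h3 : HasDerivAt (fun u : ℝ => -u ^ 2 / 2) (-u) u := by
      have := ((hasDerivAt_pow 2 u).neg).div_const 2
      refine this.congr_deriv ?_
      push_cast
      ring
    exact h3.exp
  refine ((h1.mul h2).const_mul gc).congr_deriv ?_
  simp only [gP, Polynomial.eval_sub, Polynomial.eval_mul, Polynomial.eval_X]
  ring

lemma gpsi_continuous (m : ℕ) : Continuous (gpsi m) :=
  continuous_iff_continuousAt.2 fun u => (gpsi_hasDerivAt m u).continuousAt

lemma gP_natDegree (m : ℕ) : (gP m).natDegree ≤ m := by
  induction m with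
  | zero => simp [gP]
  | succ m ih =>
    refine (Polynomial.natDegree_sub_le _ _).trans (max_le ?_ ?_)
    · exact (Polynomial.natDegree_derivative_le _).trans (by omega)
    · refine Polynomial.natDegree_mul_le.trans ?_
      have := Polynomial.natDegree_X_le (R := ℝ)
      omega

lemma gP_bound (m : ℕ) : ∃ C : ℝ, 0 < C ∧ ∀ u : ℝ, |(gP m).eval u| ≤ C * (1 + |u|) ^ m := by
  refine ⟨∑ i ∈ Finset.range (m + 1), |(gP m).coeff i| + 1, by positivity, fun u => ?_⟩
  rw [Polynomial.eval_eq_sum_range' (Nat.lt_succ_of_le (gP_natDegree m))]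
  refine (Finset.abs_sum_le_sum_abs _ _).trans ?_
  have h0 : 0 ≤ (1 + |u|) ^ m := by positivity
  rw [add_mul, Finset.sum_mul]
  refine le_add_of_le_of_nonneg (Finset.sum_le_sum fun i hi => ?_) (by positivity)
  rw [abs_mul, abs_pow]
  gcongr
  have h1 : |u| ^ i ≤ (1 + |u|) ^ i := by gcongr; linarith
  refine h1.trans (pow_le_pow_right₀ (by linarith [abs_nonneg u]) ?_)
  have := Finset.mem_range.1 hi
  omega

lemma one_add_abs_pow_le (m : ℕ) (u : ℝ) :
    (1 + |u|) ^ m ≤ (m.factorial * Real.exp 3) * Real.exp (u ^ 2 / 8) := by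
  have h0 : 0 ≤ 1 + |u| := by positivity
  have h1 := Real.pow_div_factorial_le_exp (1 + |u|) h0 m
  have h2 : 1 + |u| ≤ 3 + u ^ 2 / 8 := by nlinarith [sq_nonneg (|u| - 4), sq_abs u]
  have h3 := Real.exp_le_exp.2 h2
  rw [Real.exp_add 3] at h3
  rw [div_le_iff₀ (by positivity)] at h1
  have h4 : (0 : ℝ) < m.factorial := by positivity
  nlinarith

lemma gpsi_bound (m : ℕ) :
    ∃ C : ℝ, 0 < C ∧ ∀ u : ℝ, |gpsi m u| ≤ C * Real.exp (-(3 / 8) * u ^ 2) := by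
  obtain ⟨C, hC, h⟩ := gP_bound m
  refine ⟨gc * (C * (m.factorial * Real.exp 3)), by have := gc_pos; positivity, fun u => ?_⟩
  unfold gpsi
  rw [abs_mul, abs_mul, abs_of_pos gc_pos, abs_of_pos (Real.exp_pos _), mul_assoc]
  refine mul_le_mul_of_nonneg_left ?_ gc_pos.le
  have h1 : |(gP m).eval u| ≤ C * (m.factorial * Real.exp 3) * Real.exp (u ^ 2 / 8) := by
    refine (h u).trans ?_
    rw [mul_assoc]
    exact mul_le_mul_of_nonneg_left (one_add_abs_pow_le m u) hC.le
  refine (mul_le_mul_of_nonneg_right h1 (Real.exp_pos _).le).trans ?_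
  rw [mul_assoc, ← Real.exp_add]
  apply le_of_eq
  congr 2
  ring

lemma gpsi_integrable (m : ℕ) : Integrable (gpsi m) := by
  obtain ⟨C, hC, h⟩ := gpsi_bound m
  refine Integrable.mono' ((integrable_exp_neg_mul_sq (b := 3 / 8) (by norm_num)).const_mul C)
    (gpsi_continuous m).aestronglyMeasurable (Filter.Eventually.of_forall fun u => ?_)
  simpa using h u

lemma gpsi_integrable_sub (m : ℕ) (t : ℝ) : Integrable (fun u => gpsi m (u - t)) :=
  (gpsi_integrable m).comp_sub_right t

lemma gpsi_zero_nonneg (u : ℝ) : 0 ≤ gpsi 0 u := by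
  unfold gpsi
  have := gc_pos
  simp only [gP, Polynomial.eval_one]
  positivity

lemma gpsi_zero_integral : ∫ u, gpsi 0 u = 1 := by
  simp only [gpsi, gP, Polynomial.eval_one, one_mul]
  rw [integral_const_mul]
  have := integral_gaussian (1 / 2)
  have h2 : (fun x : ℝ => Real.exp (-(1 / 2) * x ^ 2)) = fun x => Real.exp (-x ^ 2 / 2) := by
    ext x; congr 1; ring
  rw [h2] at this
  rw [this, gc, Real.sqrt_eq_rpow, div_div_eq_mul_div, div_one, mul_comm π 2,
    ← Real.rpow_add (by positivity)]
  norm_num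

lemma gpsi_succ_integral (m : ℕ) : ∫ u, gpsi (m + 1) u = 0 :=
  integral_eq_zero_of_hasDerivAt_of_integrable (fun u => gpsi_hasDerivAt m u)
    (gpsi_integrable (m + 1)) (gpsi_integrable m)

/-- Derivatives of the smoothing of the indicator of `B` in dimension one. -/
def gE (B : Set ℝ) (m : ℕ) (t : ℝ) : ℝ := (-1) ^ m * ∫ u in B, gpsi m (u - t)

lemma gE_hasDerivAt (B : Set ℝ) (m : ℕ) (t : ℝ) :
    HasDerivAt (gE B m) (gE B (m + 1) t) t := by
  obtain ⟨C, hC, h⟩ := gpsi_bound (m + 1)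
  have key := hasDerivAt_integral_of_dominated_loc_of_deriv_le (μ := volume.restrict B)
    (F := fun t u => gpsi m (u - t)) (F' := fun t u => -gpsi (m + 1) (u - t)) (x₀ := t)
    (s := Metric.ball t 1)
    (bound := fun u => C * Real.exp (3 / 8) * Real.exp (-(3 / 16) * (u - t) ^ 2))
    (Metric.ball_mem_nhds t one_pos)
    (Filter.Eventually.of_forall fun s =>
      ((gpsi_continuous m).comp (continuous_id.sub continuous_const)).aestronglyMeasurable)
    (gpsi_integrable_sub m t).integrableOn
    ((gpsi_continuous (m + 1)).comp
      (continuous_id.sub continuous_const)).neg.aestronglyMeasurable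
    (Filter.Eventually.of_forall fun u s hs => ?_)
    ((((integrable_exp_neg_mul_sq (b := 3 / 16) (by norm_num)).comp_sub_right t).const_mul
      _).integrableOn)
    (Filter.Eventually.of_forall fun u s hs => ?_)
  · have h2 := (key.2).const_mul ((-1 : ℝ) ^ m)
    unfold gE
    refine h2.congr_deriv ?_
    rw [integral_neg]
    ring
  · rw [norm_neg, Real.norm_eq_abs, mul_assoc, ← Real.exp_add]
    refine (h _).trans (mul_le_mul_of_nonneg_left (Real.exp_le_exp.2 ?_) hC.le)
    have hs' : |s - t| < 1 := by simpa [Real.dist_eq] using hs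
    have h3 : (s - t) ^ 2 ≤ 1 := by
      rw [← sq_abs]; nlinarith [abs_nonneg (s - t)]
    nlinarith [sq_nonneg ((u - s) - (s - t))]
  · have h1 : HasDerivAt (fun s : ℝ => u - s) (-1) s := by
      simpa using (hasDerivAt_id s).const_sub u
    have := (gpsi_hasDerivAt m (u - s)).comp s h1
    simpa [Function.comp_def] using this

lemma gE_zero_nonneg (B : Set ℝ) (t : ℝ) : 0 ≤ gE B 0 t := by
  simp only [gE, pow_zero, one_mul]
  exact integral_nonneg fun u => gpsi_zero_nonneg _

lemma gE_zero_compl {B : Set ℝ} (hB : MeasurableSet B) (t : ℝ) :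
    ∫ u in Bᶜ, gpsi 0 (u - t) = 1 - gE B 0 t := by
  have h := integral_add_compl hB (gpsi_integrable_sub 0 t)
  rw [integral_sub_right_eq_self (μ := volume) (gpsi 0) t, gpsi_zero_integral] at h
  simp only [gE, pow_zero, one_mul]
  linarith

lemma gE_zero_le_one {B : Set ℝ} (hB : MeasurableSet B) (t : ℝ) : gE B 0 t ≤ 1 := by
  have h := gE_zero_compl hB t
  have : 0 ≤ ∫ u in Bᶜ, gpsi 0 (u - t) := integral_nonneg fun u => gpsi_zero_nonneg _
  linarith

lemma gE_succ_abs {B : Set ℝ} (hB : MeasurableSet B) (m : ℕ) (t : ℝ) :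
    |gE B (m + 1) t| ≤ ∫ u in Bᶜ, |gpsi (m + 1) (u - t)| := by
  have h := integral_add_compl hB (gpsi_integrable_sub (m + 1) t)
  rw [integral_sub_right_eq_self (μ := volume) (gpsi (m + 1)) t, gpsi_succ_integral] at h
  rw [gE, abs_mul, abs_pow, abs_neg, abs_one, one_pow, one_mul, eq_neg_of_add_eq_zero_left h,
    abs_neg]
  exact abs_integral_le_integral_abs

lemma gpsi_pointwise (K : ℝ) (hK : 0 ≤ K) (m : ℕ) :
    ∃ C : ℝ, 0 < C ∧ ∀ L : ℝ, 1 ≤ L → ∀ u v : ℝ, |u - v| ≤ 2 * (K / L) →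
      |gpsi m u| ≤ C * L ^ m * gpsi 0 v
        + C * Real.exp (-L ^ 2) * Real.exp (-(1 / 8) * u ^ 2) := by
  obtain ⟨C₁, hC₁, h₁⟩ := gP_bound m
  obtain ⟨C₂, hC₂, h₂⟩ := gpsi_bound m
  refine ⟨C₁ * 5 ^ m * Real.exp (8 * K + 2 * K ^ 2) + C₂, by positivity, fun L hL u v huv => ?_⟩
  have hL0 : 0 < L := by linarith
  have hv := gpsi_zero_nonneg v
  rcases le_or_gt |u| (4 * L) with hu | hu
  · have hA : |gpsi m u| ≤ C₁ * 5 ^ m * Real.exp (8 * K + 2 * K ^ 2) * L ^ m * gpsi 0 v := by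
      simp only [gpsi, gP, Polynomial.eval_one, one_mul]
      rw [abs_mul, abs_mul, abs_of_pos gc_pos, abs_of_pos (Real.exp_pos _)]
      have e1 : |(gP m).eval u| ≤ C₁ * (5 ^ m * L ^ m) := by
        refine (h₁ u).trans ?_
        rw [← mul_pow]
        gcongr
        linarith
      have e2 : Real.exp (-u ^ 2 / 2) ≤
          Real.exp (8 * K + 2 * K ^ 2) * Real.exp (-v ^ 2 / 2) := by
        rw [← Real.exp_add]
        apply Real.exp_le_exp.2
        have f0 : 0 ≤ K / L := by positivity
        have f1 : K / L ≤ K := div_le_self hK hL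
        have f2 : K / L * L = K := by field_simp
        have f3 : v ^ 2 - u ^ 2 ≤ |u - v| * (2 * |u| + |u - v|) := by
          have : v ^ 2 - u ^ 2 = -(2 * ((u - v) * u)) + (u - v) ^ 2 := by ring
          rw [this, ← sq_abs (u - v)]
          have := neg_abs_le ((u - v) * u)
          rw [abs_mul] at this
          nlinarith
        have f4 : |u - v| * (2 * |u| + |u - v|) ≤ 2 * (K / L) * (8 * L + 2 * (K / L)) := by
          refine mul_le_mul huv ?_ (by positivity) (by positivity)
          linarith
        nlinarith
      have e3 := mul_le_mul e1 e2 (Real.exp_pos _).le (by positivity)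
      have e4 := mul_le_mul_of_nonneg_left e3 gc_pos.le
      refine e4.trans (le_of_eq ?_)
      ring
    have hB : 0 ≤ C₂ * L ^ m * gpsi 0 v := by positivity
    have hD : 0 ≤ (C₁ * 5 ^ m * Real.exp (8 * K + 2 * K ^ 2) + C₂) * Real.exp (-L ^ 2) *
      Real.exp (-(1 / 8) * u ^ 2) := by positivity
    nlinarith
  · have hA : |gpsi m u| ≤ C₂ * (Real.exp (-L ^ 2) * Real.exp (-(1 / 8) * u ^ 2)) := by
      refine (h₂ u).trans ?_
      rw [← Real.exp_add]
      gcongr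
      have : (4 * L) ^ 2 ≤ u ^ 2 := by
        rw [← sq_abs u]; gcongr
      nlinarith
    have hB : 0 ≤ (C₁ * 5 ^ m * Real.exp (8 * K + 2 * K ^ 2) + C₂) * L ^ m * gpsi 0 v := by
      positivity
    have hD : 0 ≤ (C₁ * 5 ^ m * Real.exp (8 * K + 2 * K ^ 2)) *
      (Real.exp (-L ^ 2) * Real.exp (-(1 / 8) * u ^ 2)) := by positivity
    nlinarith

lemma gE_bound (K : ℝ) (hK : 0 ≤ K) (m : ℕ) :
    ∃ C : ℝ, 0 < C ∧ ∀ L : ℝ, 1 ≤ L → ∀ B : Set ℝ, MeasurableSet B →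
      ∀ s t : ℝ, |s - t| ≤ 2 * (K / L) →
      |gE B (m + 1) s| ≤ C * L ^ (m + 1) * (1 - gE B 0 t + Real.exp (-L ^ 2)) := by
  obtain ⟨C, hC, h⟩ := gpsi_pointwise K hK (m + 1)
  have hint : Integrable (fun u : ℝ => Real.exp (-(1 / 8) * u ^ 2)) :=
    integrable_exp_neg_mul_sq (by norm_num)
  set G := ∫ u : ℝ, Real.exp (-(1 / 8) * u ^ 2) with hG
  have hG0 : 0 ≤ G := integral_nonneg fun u => (Real.exp_pos _).le
  refine ⟨C * (1 + G), by positivity, fun L hL B hB s t hst => ?_⟩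
  refine (gE_succ_abs hB m s).trans ?_
  have hint2 : Integrable (fun u : ℝ => Real.exp (-(1 / 8) * (u - s) ^ 2)) :=
    hint.comp_sub_right s
  have i1 : IntegrableOn (fun u => C * L ^ (m + 1) * gpsi 0 (u - t)) Bᶜ :=
    ((gpsi_integrable_sub 0 t).const_mul _).integrableOn
  have i2 : IntegrableOn (fun u => C * Real.exp (-L ^ 2) *
      Real.exp (-(1 / 8) * (u - s) ^ 2)) Bᶜ := (hint2.const_mul _).integrableOn
  have h1 : ∫ u in Bᶜ, |gpsi (m + 1) (u - s)| ≤ ∫ u in Bᶜ, (C * L ^ (m + 1) * gpsi 0 (u - t)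
        + C * Real.exp (-L ^ 2) * Real.exp (-(1 / 8) * (u - s) ^ 2)) := by
    refine integral_mono (gpsi_integrable_sub (m + 1) s).abs.integrableOn (i1.add i2) fun u => ?_
    refine h L hL (u - s) (u - t) ?_
    rw [show u - s - (u - t) = -(s - t) by ring, abs_neg]
    exact hst
  refine h1.trans ?_
  rw [integral_add i1 i2, integral_const_mul, integral_const_mul, gE_zero_compl hB]
  have h2 : ∫ u in Bᶜ, Real.exp (-(1 / 8) * (u - s) ^ 2) ≤ G := by
    refine (setIntegral_le_integral hint2
      (Filter.Eventually.of_forall fun u => (Real.exp_pos _).le)).trans (le_of_eq ?_)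
    exact integral_sub_right_eq_self (fun u : ℝ => Real.exp (-(1 / 8) * u ^ 2)) s
  have h3 : 1 ≤ L ^ (m + 1) := one_le_pow₀ hL
  have h4 := gE_zero_le_one hB t
  have h5 : C * Real.exp (-L ^ 2) * ∫ u in Bᶜ, Real.exp (-(1 / 8) * (u - s) ^ 2) ≤
      C * L ^ (m + 1) * (Real.exp (-L ^ 2) * G) := by
    calc _ ≤ C * Real.exp (-L ^ 2) * G := by gcongr
      _ = C * 1 * (Real.exp (-L ^ 2) * G) := by ring
      _ ≤ _ := by gcongr
  have h6 : 0 ≤ C * L ^ (m + 1) * (G * (1 - gE B 0 t)) := by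
    have : 0 ≤ 1 - gE B 0 t := by linarith
    positivity
  have h7 : 0 ≤ C * L ^ (m + 1) * Real.exp (-L ^ 2) := by positivity
  nlinarith

lemma pdSeq_prod {d : ℕ} (D : Fin d → ℕ → ℝ → ℝ)
    (hD : ∀ j m t, HasDerivAt (D j m) (D j (m + 1) t) t) (J : List (Fin d)) :
    ∀ k : Fin d → ℕ, pdSeq J (fun x => ∏ j, D j (k j) (x j)) =
      fun x => ∏ j, D j (k j + J.count j) (x j) := by
  induction J with
  | nil => intro k; simp [pdSeq]
  | cons i J ih =>
    intro k
    have h : (fun x : Fin d → ℝ => fderiv ℝ (fun x : Fin d → ℝ => ∏ j, D j (k j) (x j)) x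
        (Pi.single i 1)) = fun x => ∏ j, D j (Function.update k i (k i + 1) j) (x j) := by
      funext x
      have h1 : ∀ j ∈ (Finset.univ : Finset (Fin d)),
          HasFDerivAt (fun x : Fin d → ℝ => D j (k j) (x j))
            (D j (k j + 1) (x j) • ContinuousLinearMap.proj (R := ℝ) (φ := fun _ : Fin d => ℝ) j)
            x := fun j _ =>
        HasDerivAt.comp_hasFDerivAt x (hD j (k j) (x j))
          (ContinuousLinearMap.proj (R := ℝ) (φ := fun _ : Fin d => ℝ) j).hasFDerivAt
      have h2 := HasFDerivAt.finsetProd h1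
      rw [h2.fderiv]
      simp only [sum_apply, smul_apply,
        ContinuousLinearMap.proj_apply, smul_eq_mul]
      rw [Finset.sum_eq_single i]
      · rw [← Finset.prod_erase_mul _ _ (Finset.mem_univ i)]
        simp only [Pi.single_eq_same, mul_one, Function.update_self]
        congr 1
        refine Finset.prod_congr rfl fun j hj => ?_
        rw [Function.update_of_ne (Finset.ne_of_mem_erase hj)]
      · intro j _ hj
        simp [hj]
      · simp
    rw [pdSeq, h, ih]
    funext x
    refine Finset.prod_congr rfl fun j _ => ?_
    by_cases hj : j = i
    · subst hj
      simp only [Function.update_self, List.count_cons_self]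
      rw [add_assoc, add_comm 1]
    · rw [Function.update_of_ne hj, List.count_cons_of_ne (Ne.symm hj)]

lemma gaussianSmooth_prod {d : ℕ} (σ : ℝ) (hσ : 0 < σ) (I : Fin d → Set ℝ)
    (hI : ∀ j, MeasurableSet (I j)) :
    gaussianSmooth σ (Set.indicator {x : Fin d → ℝ | ∀ j, x j ∈ I j} 1) =
      fun x => ∏ j, gE {u | σ * u ∈ I j} 0 (x j / σ) := by
  funext x
  unfold gaussianSmooth
  have h1 : ∀ z : Fin d → ℝ, Set.indicator {x : Fin d → ℝ | ∀ j, x j ∈ I j} 1 (x + σ • z) *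
      stdGaussianPdf d z = ∏ j, (Set.indicator (I j) 1 (x j + σ * z j) * gpsi 0 (z j)) := by
    intro z
    rw [Finset.prod_mul_distrib]
    congr 1
    · by_cases hz : ∀ j, (x + σ • z) j ∈ I j
      · rw [Set.indicator_of_mem (by exact hz)]
        symm
        refine Finset.prod_eq_one fun j _ => ?_
        have : x j + σ * z j ∈ I j := hz j
        rw [Set.indicator_of_mem this]
        rfl
      · rw [Set.indicator_of_notMem (by exact hz)]
        push Not at hz
        obtain ⟨j, hj⟩ := hz
        symm
        refine Finset.prod_eq_zero (Finset.mem_univ j) ?_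
        have : x j + σ * z j ∉ I j := hj
        rw [Set.indicator_of_notMem this]
    · simp only [gpsi, gP, Polynomial.eval_one, one_mul]
      rw [Finset.prod_mul_distrib, ← Real.exp_sum, stdGaussianPdf]
      congr 1
      · simp only [Finset.prod_const, Finset.card_univ, Fintype.card_fin, gc]
        rw [← Real.rpow_natCast, ← Real.rpow_mul (by positivity)]
        congr 1
        ring
      · rw [← Finset.sum_div, Finset.sum_neg_distrib]
  simp_rw [h1]
  rw [integral_fintype_prod_volume_eq_prod
    (f := fun j (z : ℝ) => Set.indicator (I j) 1 (x j + σ * z) * gpsi 0 z)]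
  refine Finset.prod_congr rfl fun j _ => ?_
  rw [← integral_sub_right_eq_self _ (x j / σ)]
  simp only [gE, pow_zero, one_mul]
  have hm : MeasurableSet {u : ℝ | σ * u ∈ I j} := (hI j).preimage (measurable_const_mul σ)
  rw [← integral_indicator hm]
  refine integral_congr_ae (Filter.Eventually.of_forall fun u => ?_)
  have : x j + σ * (u - x j / σ) = σ * u := by field_simp; ring
  simp only [this]
  by_cases hu : σ * u ∈ I j
  · rw [Set.indicator_of_mem hu, Set.indicator_of_mem (by exact hu)]; simp
  · rw [Set.indicator_of_notMem hu, Set.indicator_of_notMem (by exact hu)]; simp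

lemma sum_image_le {d r : ℕ} (F : Finset (Fin d) → ℝ) (hF : ∀ S, 0 ≤ F S) :
    ∑ J : Fin r → Fin d, F (Finset.univ.image J) ≤ (r : ℝ) ^ r * ∑ S, F S := by
  rw [← Finset.sum_fiberwise (s := Finset.univ) (g := fun J : Fin r → Fin d =>
    Finset.univ.image J), Finset.mul_sum]
  refine Finset.sum_le_sum fun S _ => ?_
  have h1 : ∑ J ∈ Finset.univ.filter (fun J : Fin r → Fin d => Finset.univ.image J = S),
      F (Finset.univ.image J) =
      ∑ J ∈ Finset.univ.filter (fun J : Fin r → Fin d => Finset.univ.image J = S), F S :=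
    Finset.sum_congr rfl fun J hJ => by rw [(Finset.mem_filter.1 hJ).2]
  rw [h1, Finset.sum_const, nsmul_eq_mul]
  refine mul_le_mul_of_nonneg_right ?_ (hF S)
  by_cases hS : S.card ≤ r
  · have h2 : Finset.univ.filter (fun J : Fin r → Fin d => Finset.univ.image J = S) ⊆
        Fintype.piFinset fun _ => S := by
      intro J hJ
      rw [Fintype.mem_piFinset]
      intro i
      rw [← (Finset.mem_filter.1 hJ).2]
      exact Finset.mem_image_of_mem _ (Finset.mem_univ i)
    have h3 := Finset.card_le_card h2
    rw [Fintype.card_piFinset_const] at h3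
    have h4 : S.card ^ r ≤ r ^ r := Nat.pow_le_pow_left hS r
    exact_mod_cast h3.trans h4
  · rw [Finset.filter_eq_empty_iff.2]
    · simp
    · intro J _ hJ
      apply hS
      rw [← hJ]
      simpa using Finset.card_image_le (s := Finset.univ) (f := J)

lemma sum_subsets_le {d : ℕ} (hd : 0 < d) (e : Fin d → ℝ) :
    ∑ S : Finset (Fin d), (∏ j ∈ S, (e j + 1 / (d : ℝ))) * ∏ j ∈ Finset.univ \ S, (1 - e j) ≤
      Real.exp 1 := by
  have h := Finset.prod_add (fun j : Fin d => e j + 1 / (d : ℝ)) (fun j => 1 - e j) Finset.univ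
  rw [Finset.powerset_univ] at h
  rw [← h]
  have h2 : ∀ j, e j + 1 / (d : ℝ) + (1 - e j) = 1 / (d : ℝ) + 1 := fun j => by ring
  simp only [h2, Finset.prod_const, Finset.card_univ, Fintype.card_fin]
  have hd' : (0 : ℝ) < d := by exact_mod_cast hd
  calc (1 / (d : ℝ) + 1) ^ d ≤ (Real.exp (1 / (d : ℝ))) ^ d := by
        gcongr
        exact Real.add_one_le_exp _
    _ = Real.exp 1 := by
        rw [← Real.exp_nat_mul]; congr 1; field_simp

lemma sum_count {d r : ℕ} (J : Fin r → Fin d) : ∑ j, (List.ofFn J).count j = r := by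
  have := List.sum_toFinset_count_eq_length (List.ofFn J)
  rw [List.length_ofFn] at this
  refine Eq.trans ?_ this
  symm
  apply Finset.sum_subset (Finset.subset_univ _)
  intro j _ hj
  rw [List.count_eq_zero]
  simpa using hj

/-- **Lemma 3 (derivative bounds for Gaussian smoothings of rectangle indicators).** -/
theorem sum_sup_deriv_gaussianSmooth_le
    (K : ℝ) (hK : 0 ≤ K) (r : ℕ) (hr : 1 ≤ r) :
    ∃ C : ℝ, 0 < C ∧
      ∀ (d : ℕ), 3 ≤ d →
      ∀ σ : ℝ, 0 < σ →
      ∀ A : Set (Fin d → ℝ), IsHyperrectangle A →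
      ∀ x : Fin d → ℝ,
        ∑ J : Fin r → Fin d,
          ⨆ y : {y : Fin d → ℝ // ‖y‖ ≤ σ * (K / Real.sqrt (Real.log d))},
            |pdSeq (List.ofFn J) (gaussianSmooth σ (Set.indicator A 1)) (x + y.1)| ≤
        C * σ ^ (-(r : ℝ)) * (Real.log d) ^ ((r : ℝ) / 2) := by
  choose Cf hCf0 hCf using gE_bound K hK
  set C1 : ℝ := 1 + ∑ m ∈ Finset.range r, Cf m with hC1
  have hsum0 : 0 ≤ ∑ m ∈ Finset.range r, Cf m := Finset.sum_nonneg fun m _ => (hCf0 m).le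
  have hC1one : 1 ≤ C1 := by linarith
  have hCfle : ∀ m, m < r → Cf m ≤ C1 := fun m hm => by
    have := Finset.single_le_sum (f := Cf) (fun m _ => (hCf0 m).le) (Finset.mem_range.2 hm)
    linarith
  have hr0 : (0 : ℝ) < r := by exact_mod_cast hr
  refine ⟨C1 ^ r * (r ^ r * Real.exp 1), by positivity, ?_⟩
  intro d hd σ hσ A hA x
  obtain ⟨a, b, rfl⟩ := hA
  have hd3 : (3 : ℝ) ≤ d := by exact_mod_cast hd
  have hd0 : (0 : ℝ) < d := by linarith
  have hlog : 1 ≤ Real.log d := by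
    rw [Real.le_log_iff_exp_le hd0]
    linarith [Real.exp_one_lt_d9]
  set L := Real.sqrt (Real.log d) with hLdef
  have hL1 : 1 ≤ L := Real.one_le_sqrt.2 hlog
  have hL0 : 0 < L := by linarith
  have hLsq : L ^ 2 = Real.log d := Real.sq_sqrt (by linarith)
  have hexp : Real.exp (-L ^ 2) = 1 / (d : ℝ) := by
    rw [hLsq, Real.exp_neg, Real.exp_log hd0, one_div]
  set I : Fin d → Set ℝ := fun j => {t : ℝ | a j < (t : EReal) ∧ (t : EReal) < b j} with hI
  have hIm : ∀ j, MeasurableSet (I j) := fun j =>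
    (measurableSet_lt measurable_const measurable_coe_real_ereal).inter
      (measurableSet_lt measurable_coe_real_ereal measurable_const)
  have hsm := gaussianSmooth_prod σ hσ I hIm
  set B : Fin d → Set ℝ := fun j => {u | σ * u ∈ I j} with hBdef
  have hBm : ∀ j, MeasurableSet (B j) := fun j => (hIm j).preimage (measurable_const_mul σ)
  set D : Fin d → ℕ → ℝ → ℝ := fun j m t => (1 / σ) ^ m * gE (B j) m (t / σ) with hD
  have hDd : ∀ j m t, HasDerivAt (D j m) (D j (m + 1) t) t := by
    intro j m t
    have h1 : HasDerivAt (fun t : ℝ => t / σ) (1 / σ) t := (hasDerivAt_id t).div_const σ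
    have h2 := ((gE_hasDerivAt (B j) m (t / σ)).comp t h1).const_mul ((1 / σ) ^ m)
    refine h2.congr_deriv ?_
    simp only [hD]
    ring
  have hpd : ∀ J : List (Fin d), pdSeq J (gaussianSmooth σ
      (Set.indicator {x : Fin d → ℝ | ∀ j, a j < (x j : EReal) ∧ (x j : EReal) < b j} 1)) =
      fun x => ∏ j, D j (J.count j) (x j) := by
    intro J
    have h1 := pdSeq_prod D hDd J (fun _ => 0)
    simp only [zero_add] at h1
    rw [← h1]
    congr 1
    refine Eq.trans hsm ?_
    funext x
    simp [hD, hBdef]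
  have hKL : 0 ≤ K / L := by positivity
  have hmax : ∀ j, ∃ τ, |τ - x j / σ| ≤ K / L ∧
      ∀ s, |s - x j / σ| ≤ K / L → gE (B j) 0 s ≤ gE (B j) 0 τ := by
    intro j
    have hc : Continuous (gE (B j) 0) :=
      continuous_iff_continuousAt.2 fun t => (gE_hasDerivAt (B j) 0 t).continuousAt
    obtain ⟨τ, hτ, hm⟩ := (isCompact_closedBall (x j / σ) (K / L)).exists_isMaxOn
      ⟨x j / σ, Metric.mem_closedBall_self hKL⟩ hc.continuousOn
    refine ⟨τ, by simpa [Real.dist_eq] using hτ, fun s hs => hm ?_⟩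
    simpa [Real.dist_eq] using hs
  choose τ hτ hτm using hmax
  set e : Fin d → ℝ := fun j => 1 - gE (B j) 0 (τ j) with he
  have he0 : ∀ j, 0 ≤ e j := fun j => by
    have := gE_zero_le_one (hBm j) (τ j)
    simp only [he]; linarith
  have he1 : ∀ j, 0 ≤ 1 - e j := fun j => by
    have := gE_zero_nonneg (B j) (τ j)
    simp only [he]; linarith
  set F : Finset (Fin d) → ℝ := fun S =>
    (∏ j ∈ S, (e j + 1 / (d : ℝ))) * ∏ j ∈ Finset.univ \ S, (1 - e j) with hF
  have hF0 : ∀ S, 0 ≤ F S := fun S => mul_nonneg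
    (Finset.prod_nonneg fun j _ => by have := he0 j; positivity)
    (Finset.prod_nonneg fun j _ => he1 j)
  have hterm : ∀ J : Fin r → Fin d,
      (⨆ y : {y : Fin d → ℝ // ‖y‖ ≤ σ * (K / L)},
        |pdSeq (List.ofFn J) (gaussianSmooth σ (Set.indicator
          {x : Fin d → ℝ | ∀ j, a j < (x j : EReal) ∧ (x j : EReal) < b j} 1)) (x + y.1)|) ≤
      (C1 ^ r * (L / σ) ^ r) * F (Finset.univ.image J) := by
    intro J
    have hnn : 0 ≤ (C1 ^ r * (L / σ) ^ r) * F (Finset.univ.image J) :=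
      mul_nonneg (by positivity) (hF0 _)
    refine Real.iSup_le (fun y => ?_) hnn
    rw [hpd]
    simp only [Finset.abs_prod]
    set S := Finset.univ.image J with hS
    set n : Fin d → ℕ := fun j => (List.ofFn J).count j with hn
    have hnsum : ∑ j, n j = r := sum_count J
    have hnr : ∀ j, n j ≤ r := fun j => by
      rw [← hnsum]
      exact Finset.single_le_sum (f := n) (fun _ _ => Nat.zero_le _) (Finset.mem_univ j)
    have hnS : ∀ j, j ∉ S → n j = 0 := by
      intro j hj
      simp only [hn, List.count_eq_zero, List.mem_ofFn]
      rintro ⟨i, rfl⟩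
      exact hj (Finset.mem_image_of_mem _ (Finset.mem_univ i))
    have hnS' : ∀ j, j ∈ S → n j ≠ 0 := by
      intro j hj h0
      obtain ⟨i, _, rfl⟩ := Finset.mem_image.1 hj
      simp only [hn, List.count_eq_zero, List.mem_ofFn] at h0
      exact h0 ⟨i, rfl⟩
    have hyj : ∀ j, |(x + y.1) j / σ - x j / σ| ≤ K / L := by
      intro j
      have h1 : |y.1 j| ≤ σ * (K / L) := (norm_le_pi_norm y.1 j).trans y.2
      rw [Pi.add_apply, ← sub_div, add_sub_cancel_left, abs_div, abs_of_pos hσ,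
        div_le_iff₀ hσ]
      linarith
    have hbd : ∀ j, |D j (n j) ((x + y.1) j)| ≤
        (L / σ) ^ n j * (if j ∈ S then C1 * (e j + 1 / (d : ℝ)) else 1 - e j) := by
      intro j
      by_cases hj : j ∈ S
      · rw [if_pos hj]
        obtain ⟨m, hm⟩ := Nat.exists_eq_succ_of_ne_zero (hnS' j hj)
        have hmr : m < r := by have := hnr j; omega
        rw [hm]
        simp only [hD, Nat.succ_eq_add_one]
        have h1 := hCf m L hL1 (B j) (hBm j) ((x + y.1) j / σ) (τ j) (by
          have h2 := abs_sub_le ((x + y.1) j / σ) (x j / σ) (τ j)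
          have h3 := hτ j
          rw [abs_sub_comm] at h3
          have h4 := hyj j
          linarith)
        rw [hexp] at h1
        rw [abs_mul, abs_of_pos (show 0 < (1 / σ) ^ (m + 1) by positivity)]
        have h5 : 0 ≤ e j + 1 / (d : ℝ) := by have := he0 j; positivity
        have h6 : |gE (B j) (m + 1) ((x + y.1) j / σ)| ≤
            C1 * L ^ (m + 1) * (e j + 1 / (d : ℝ)) := by
          refine h1.trans ?_
          have := hCfle m hmr
          gcongr
        refine (mul_le_mul_of_nonneg_left h6 (by positivity)).trans (le_of_eq ?_)
        rw [div_pow, div_pow, one_pow]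
        ring
      · rw [if_neg hj, hnS j hj]
        simp only [hD, pow_zero, one_mul]
        rw [abs_of_nonneg (gE_zero_nonneg _ _)]
        have := hτm j _ (hyj j)
        simp only [he]
        linarith
    refine (Finset.prod_le_prod (fun j _ => abs_nonneg _) fun j _ => hbd j).trans ?_
    rw [Finset.prod_mul_distrib, Finset.prod_pow_eq_pow_sum, hnsum,
      ← Finset.prod_sdiff (Finset.subset_univ S)]
    have hp1 : ∏ j ∈ Finset.univ \ S, (if j ∈ S then C1 * (e j + 1 / (d : ℝ)) else 1 - e j) =
        ∏ j ∈ Finset.univ \ S, (1 - e j) :=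
      Finset.prod_congr rfl fun j hj => if_neg (Finset.mem_sdiff.1 hj).2
    have hp2 : ∏ j ∈ S, (if j ∈ S then C1 * (e j + 1 / (d : ℝ)) else 1 - e j) =
        C1 ^ S.card * ∏ j ∈ S, (e j + 1 / (d : ℝ)) := by
      rw [Finset.prod_congr rfl fun j hj => if_pos hj, Finset.prod_mul_distrib,
        Finset.prod_const]
    rw [hp1, hp2]
    have hcard : S.card ≤ r := by
      simpa using Finset.card_image_le (s := Finset.univ) (f := J)
    have hpow : C1 ^ S.card ≤ C1 ^ r := pow_le_pow_right₀ hC1one hcard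
    have hw : 0 ≤ (L / σ) ^ r := by positivity
    calc _ = C1 ^ S.card * ((L / σ) ^ r * F S) := by simp only [hF]; ring
      _ ≤ C1 ^ r * ((L / σ) ^ r * F S) :=
        mul_le_mul_of_nonneg_right hpow (mul_nonneg hw (hF0 S))
      _ = _ := by ring
  refine (Finset.sum_le_sum fun J _ => hterm J).trans ?_
  rw [← Finset.mul_sum]
  have h1 := (sum_image_le (r := r) F hF0).trans
    (mul_le_mul_of_nonneg_left (sum_subsets_le (by omega) e) (by positivity))
  have hpow1 : (Real.log d) ^ ((r : ℝ) / 2) = L ^ r := by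
    rw [← hLsq, ← Real.rpow_natCast, ← Real.rpow_mul hL0.le, ← Real.rpow_natCast]
    congr 1
    push_cast
    ring
  have hpow2 : σ ^ (-(r : ℝ)) = (σ ^ r)⁻¹ := by
    rw [Real.rpow_neg hσ.le, Real.rpow_natCast]
  rw [hpow1, hpow2]
  refine (mul_le_mul_of_nonneg_left h1 (by positivity)).trans (le_of_eq ?_)
  rw [div_pow]
  ring
end
end

section
/- Let φ₁ and Φ₁ denote the standard normal density and distribution function on ℝ, let ν ≥ 1 be an integer, H_ν the ν-th (probabilists') Hermite polynomial, u_ν the maximum real root of H_ν, h̄_ν(u) = H_{ν−1}(u) φ₁(u)/Φ₁(u), and for a fixed η ≥ 0 let λ(u) = e^{2uη + 2η²}. Then the function u ↦ H_ν(u) λ(u) + h̄_ν(u) is strictly increasing on [u_ν, ∞). -/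
open MeasureTheory Real Polynomial

noncomputable section

/-- The standard normal density on `ℝ`. -/
def gaussD (u : ℝ) : ℝ := (Real.sqrt (2 * π))⁻¹ * Real.exp (-u ^ 2 / 2)

/-- The standard normal distribution function on `ℝ`. -/
def gaussCdf (u : ℝ) : ℝ := ∫ t in Set.Iic u, gaussD t

/-- The `ν`-th (probabilists') Hermite polynomial, evaluated at a real number. -/
def hermiteR (ν : ℕ) (u : ℝ) : ℝ := Polynomial.aeval u (Polynomial.hermite ν)


lemma gaussD_pos (u : ℝ) : 0 < gaussD u := by
  unfold gaussD; positivity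

lemma gaussD_hasDerivAt (u : ℝ) : HasDerivAt gaussD (-u * gaussD u) u := by
  have h1 : HasDerivAt (fun x : ℝ => -x ^ 2 / 2) (-u) u := by
    have := ((hasDerivAt_pow 2 u).neg).div_const 2
    refine this.congr_deriv ?_
    norm_num
    ring
  have := (h1.exp).const_mul ((Real.sqrt (2 * π))⁻¹)
  refine this.congr_deriv ?_
  unfold gaussD
  ring

lemma gaussD_cont : Continuous gaussD :=
  continuous_iff_continuousAt.2 fun u => (gaussD_hasDerivAt u).continuousAt

lemma gaussD_eq : gaussD = fun t => (Real.sqrt (2 * π))⁻¹ * Real.exp (-(1 / 2) * t ^ 2) := by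
  funext t
  unfold gaussD
  congr 2
  ring

lemma gaussD_int : Integrable gaussD := by
  rw [gaussD_eq]
  exact (integrable_exp_neg_mul_sq (by norm_num)).const_mul _

lemma gaussCdf_eq (u : ℝ) : gaussCdf u = gaussCdf 0 + ∫ t in (0 : ℝ)..u, gaussD t := by
  rw [← intervalIntegral.integral_Iic_sub_Iic gaussD_int.integrableOn gaussD_int.integrableOn]
  unfold gaussCdf
  ring

lemma gaussCdf_hasDerivAt (u : ℝ) : HasDerivAt gaussCdf (gaussD u) u := by
  have h := (gaussD_cont.integral_hasStrictDerivAt 0 u).hasDerivAt.const_add (gaussCdf 0)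
  have e : gaussCdf = fun u => gaussCdf 0 + ∫ t in (0 : ℝ)..u, gaussD t := funext gaussCdf_eq
  rw [e]
  exact h

lemma gaussCdf_zero : gaussCdf 0 = 1 / 2 := by
  have h := integral_comp_neg_Iic 0 gaussD
  have h2 : (fun x => gaussD (-x)) = gaussD := by
    funext x; simp [gaussD]
  have h3 : ∫ x in Set.Iic (0 : ℝ), gaussD x = ∫ x in Set.Ioi (0 : ℝ), gaussD x := by
    rw [neg_zero] at h
    rw [← h]
    simp only [gaussD, neg_sq]
  unfold gaussCdf
  rw [h3, gaussD_eq, integral_const_mul, integral_gaussian_Ioi]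
  have : π / (1 / 2) = 2 * π := by ring
  rw [this]
  have : 0 < √(2 * π) := by positivity
  field_simp

lemma gaussCdf_half {u : ℝ} (hu : 0 ≤ u) : 1 / 2 ≤ gaussCdf u := by
  have hm : StrictMono gaussCdf := strictMono_of_deriv_pos fun x => by
    rw [(gaussCdf_hasDerivAt x).deriv]; exact gaussD_pos x
  rw [← gaussCdf_zero]
  exact hm.monotone hu

lemma mills_key {u : ℝ} (hu : 0 ≤ u) :
    0 < gaussCdf u ^ 2 - u * gaussD u * gaussCdf u - gaussD u ^ 2 := by
  have hd : ∀ x, HasDerivAt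
      (fun u => gaussCdf u ^ 2 - u * gaussD u * gaussCdf u - gaussD u ^ 2)
      (gaussD x * gaussCdf x * (1 + x ^ 2) + x * gaussD x ^ 2) x := by
    intro x
    have a := gaussCdf_hasDerivAt x
    have b := gaussD_hasDerivAt x
    have := ((a.pow 2).sub (((hasDerivAt_id x).mul b).mul a)).sub (b.pow 2)
    refine this.congr_deriv ?_
    simp
    ring
  have hm : MonotoneOn
      (fun u => gaussCdf u ^ 2 - u * gaussD u * gaussCdf u - gaussD u ^ 2) (Set.Ici 0) := by
    apply monotoneOn_of_deriv_nonneg (convex_Ici 0)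
    · exact fun x _ => (hd x).continuousAt.continuousWithinAt
    · exact fun x _ => (hd x).differentiableAt.differentiableWithinAt
    · intro x hx
      rw [interior_Ici, Set.mem_Ioi] at hx
      rw [(hd x).deriv]
      have := gaussD_pos x
      have := gaussCdf_half hx.le
      have : 0 < gaussCdf x := by linarith
      positivity
  have h0 := hm (Set.mem_Ici.2 le_rfl) (Set.mem_Ici.2 hu) hu
  refine lt_of_lt_of_le ?_ h0
  simp only [gaussCdf_zero, zero_mul]
  have : gaussD 0 ^ 2 = (2 * π)⁻¹ := by
    simp only [gaussD]
    rw [mul_pow, inv_pow, Real.sq_sqrt (by positivity)]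
    simp
  rw [this]
  have h3 := Real.pi_gt_three
  have : (2 * π)⁻¹ < 6⁻¹ := by
    apply inv_strictAnti₀ <;> linarith
  norm_num at this ⊢
  linarith

lemma derivative_hermite_succ (n : ℕ) :
    derivative (hermite (n + 1)) = ((n : ℤ[X]) + 1) * hermite n := by
  induction n with
  | zero => simp
  | succ n ih =>
    rw [hermite_succ (n + 1), derivative_sub, derivative_mul, ih, hermite_succ n]
    have : derivative (((n : ℤ[X]) + 1) * hermite n) = ((n : ℤ[X]) + 1) * derivative (hermite n) := by
      simp
    rw [this]
    simp
    ring

lemma hermiteR_hasDerivAt' (n : ℕ) (u : ℝ) :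
    HasDerivAt (hermiteR n) (aeval u (derivative (hermite n))) u :=
  (hermite n).hasDerivAt_aeval u

lemma hermiteR_succ (n : ℕ) (u : ℝ) :
    hermiteR (n + 1) u = u * hermiteR n u - aeval u (derivative (hermite n)) := by
  simp [hermiteR, hermite_succ]

lemma hermiteR_hasDerivAt (n : ℕ) (u : ℝ) :
    HasDerivAt (hermiteR (n + 1)) ((n + 1) * hermiteR n u) u := by
  have := hermiteR_hasDerivAt' (n + 1) u
  rw [derivative_hermite_succ] at this
  simpa [hermiteR] using this

lemma hermiteR_cont (n : ℕ) : Continuous (hermiteR n) :=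
  continuous_iff_continuousAt.2 fun u => (hermiteR_hasDerivAt' n u).continuousAt

lemma hermiteR_mul_hasDerivAt (n : ℕ) (u : ℝ) :
    HasDerivAt (fun u => hermiteR n u * gaussD u) (-(hermiteR (n + 1) u * gaussD u)) u := by
  refine ((hermiteR_hasDerivAt' n u).mul (gaussD_hasDerivAt u)).congr_deriv ?_
  rw [hermiteR_succ]
  ring

lemma hermiteR_eventually (n : ℕ) : ∀ᶠ u in Filter.atTop, 0 < hermiteR n u := by
  rcases n with _ | n
  · simp [hermiteR]
  · have hm := (hermite_monic (n + 1)).map (Int.castRingHom ℝ)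
    have hdeg : 0 < ((hermite (n + 1)).map (Int.castRingHom ℝ)).degree := by
      rw [(hermite_monic (n + 1)).degree_map, degree_hermite]
      exact_mod_cast Nat.succ_pos n
    have := tendsto_atTop_of_leadingCoeff_nonneg _ hdeg (by rw [hm.leadingCoeff]; norm_num)
    filter_upwards [this.eventually_gt_atTop 0] with u hu
    rw [hermiteR, aeval_def, ← eval_map]
    exact hu

lemma hermiteR_pred_pos (n : ℕ) (u : ℝ) (h : ∀ t, u < t → 0 < hermiteR (n + 1) t) :
    ∀ t, u ≤ t → 0 < hermiteR n t := by
  have hanti : StrictAntiOn (fun u => hermiteR n u * gaussD u) (Set.Ici u) := by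
    apply strictAntiOn_of_deriv_neg (convex_Ici u)
    · exact fun x _ => (hermiteR_mul_hasDerivAt n x).continuousAt.continuousWithinAt
    · intro x hx
      rw [interior_Ici, Set.mem_Ioi] at hx
      rw [(hermiteR_mul_hasDerivAt n x).deriv]
      have := mul_pos (h x hx) (gaussD_pos x)
      linarith
  intro t ht
  by_contra hneg
  push Not at hneg
  obtain ⟨s, hs, hts⟩ := ((hermiteR_eventually n).and (Filter.eventually_gt_atTop t)).exists
  have h1 := hanti (Set.mem_Ici.2 ht) (Set.mem_Ici.2 (ht.trans hts.le)) hts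
  have h2 := mul_pos hs (gaussD_pos s)
  have h3 := mul_nonpos_of_nonpos_of_nonneg hneg (gaussD_pos t).le
  simp only at h1
  linarith

lemma hermiteR_nonneg_pt (n : ℕ) : ∀ u : ℝ, (∀ t, u < t → 0 < hermiteR (n + 1) t) → 0 ≤ u := by
  induction n with
  | zero =>
    intro u h
    by_contra hu
    push Not at hu
    have := h 0 hu
    simp [hermiteR] at this
  | succ n ih =>
    intro u h
    exact ih u fun t ht => hermiteR_pred_pos (n + 1) u h t ht.le

lemma hermiteR_pos_of_greatest (n : ℕ) (a : ℝ) (ha : IsGreatest {u : ℝ | hermiteR n u = 0} a) :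
    ∀ t, a < t → 0 < hermiteR n t := by
  intro t ht
  by_contra hneg
  push Not at hneg
  obtain ⟨s, hs, hts⟩ := ((hermiteR_eventually n).and (Filter.eventually_gt_atTop t)).exists
  obtain ⟨c, hc, hc0⟩ := intermediate_value_Icc hts.le (hermiteR_cont n).continuousOn
    (Set.mem_Icc.2 ⟨hneg, hs.le⟩)
  have := ha.2 hc0
  linarith [hc.1]

/-- **Lemma 6: `u ↦ H_ν(u) λ(u) + h̄_ν(u)` is strictly increasing on `[u_ν, ∞)`.** -/
theorem hermite_lambda_strictMono
    (ν : ℕ) (hν : 1 ≤ ν)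
    (uν : ℝ) (huν : IsGreatest {u : ℝ | hermiteR ν u = 0} uν)
    (η : ℝ) (hη : 0 ≤ η) :
    StrictMonoOn
      (fun u => hermiteR ν u * Real.exp (2 * u * η + 2 * η ^ 2) +
        hermiteR (ν - 1) u * gaussD u / gaussCdf u)
      (Set.Ici uν) := by
  obtain ⟨n, rfl⟩ : ∃ n, ν = n + 1 := ⟨ν - 1, by omega⟩
  simp only [Nat.add_sub_cancel]
  have hpos := hermiteR_pos_of_greatest _ _ huν
  have hu0 := hermiteR_nonneg_pt n uν hpos
  have hprev := hermiteR_pred_pos n uν hpos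
  have hder : ∀ x, uν ≤ x → 0 ≤ aeval x (derivative (hermite n)) := by
    rcases n with _ | m
    · intro x _; simp
    · intro x hx
      have := hermiteR_pred_pos m uν (fun t ht => hprev t ht.le) x hx
      rw [derivative_hermite_succ]
      have e : aeval x (((m : ℤ[X]) + 1) * hermite m) = ((m : ℝ) + 1) * hermiteR m x := by
        simp [hermiteR]
      rw [e]
      positivity
  have hd : ∀ x, uν ≤ x → HasDerivAt
      (fun u => hermiteR (n + 1) u * Real.exp (2 * u * η + 2 * η ^ 2) +
        hermiteR n u * gaussD u / gaussCdf u)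
      (((n + 1) * hermiteR n x) * Real.exp (2 * x * η + 2 * η ^ 2) +
        hermiteR (n + 1) x * (Real.exp (2 * x * η + 2 * η ^ 2) * (2 * η)) +
        (-(hermiteR (n + 1) x * gaussD x) * gaussCdf x - hermiteR n x * gaussD x * gaussD x)
          / gaussCdf x ^ 2) x := by
    intro x hx
    have hP := gaussCdf_half (hu0.trans hx)
    have hl : HasDerivAt (fun u : ℝ => 2 * u * η + 2 * η ^ 2) (2 * η) x := by
      have := (((hasDerivAt_id x).const_mul 2).mul_const η).add_const (2 * η ^ 2)
      simpa using this
    exact ((hermiteR_hasDerivAt n x).mul hl.exp).add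
      ((hermiteR_mul_hasDerivAt n x).div (gaussCdf_hasDerivAt x) (by linarith))
  apply strictMonoOn_of_deriv_pos (convex_Ici uν)
  · exact fun x hx => (hd x hx).continuousAt.continuousWithinAt
  · intro x hx
    rw [interior_Ici, Set.mem_Ioi] at hx
    rw [(hd x hx.le).deriv]
    have hx0 : 0 ≤ x := hu0.trans hx.le
    have hP : 0 < gaussCdf x := by linarith [gaussCdf_half hx0]
    have hD := gaussD_pos x
    have hK := hpos x hx
    have hh := hprev x hx.le
    have hKle : hermiteR (n + 1) x ≤ x * hermiteR n x := by
      rw [hermiteR_succ]; linarith [hder x hx.le]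
    have hL : 1 ≤ Real.exp (2 * x * η + 2 * η ^ 2) := by
      apply Real.one_le_exp; positivity
    have hkey := mills_key hx0
    have h1 : hermiteR n x ≤ ((n + 1) * hermiteR n x) * Real.exp (2 * x * η + 2 * η ^ 2) := by
      have : hermiteR n x ≤ (n + 1) * hermiteR n x := by
        have : 0 ≤ (n : ℝ) * hermiteR n x := by positivity
        linarith
      exact this.trans (le_mul_of_one_le_right (by positivity) hL)
    have h2 : 0 ≤ hermiteR (n + 1) x * (Real.exp (2 * x * η + 2 * η ^ 2) * (2 * η)) := by
      positivity
    have h3 : -hermiteR n x <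
        (-(hermiteR (n + 1) x * gaussD x) * gaussCdf x - hermiteR n x * gaussD x * gaussD x)
          / gaussCdf x ^ 2 := by
      rw [lt_div_iff₀ (by positivity)]
      have a := mul_pos hh hkey
      have b := mul_le_mul_of_nonneg_right hKle (mul_pos hD hP).le
      nlinarith
    linarith
end
end
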